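/- arXiv:1205.4104 — 4 statements merged into one kernel-verified Lean document; each statement's English description precedes it below -/
import Mathlib

section
/- Let M be a finite set of goods, let v_1, …, v_n be graph valuations (hypergraph valuations all of whose hyperedges have exactly 2 elements) on M with nonnegative weights, let A be an allocation assigning each good of M to one of the n players with welfare β = Σ_{ℓ=1}^n v_ℓ(A^{-1}(ℓ)), and let P_0, …, P_k be a partition of M into k+1 parts. Then there exists an index i ∈ {0, …, k} and an allocation A_i assigning each good of M ∖ P_i to one of the n players (leaving the goods of P_i unallocated) whose welfare Σ_{ℓ=1}^n v_ℓ(A_i^{-1}(ℓ)) is at least (1 − 2/(k+1))·β. -/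
/-- A finite set meets at most as many members of a pairwise disjoint family as it has elements. -/
theorem card_filter_not_disjoint_le {α κ : Type*} [DecidableEq α] [Fintype κ]
    (P : κ → Finset α) (hP : ∀ i j, i ≠ j → Disjoint (P i) (P j)) (e : Finset α) :
    (Finset.univ.filter (fun i => ¬ Disjoint e (P i))).card ≤ e.card := by
  refine Finset.card_le_card_of_forall_subsingleton (fun i x => x ∈ P i) ?_ ?_
  · intro i hi
    obtain ⟨x, hxe, hxP⟩ := Finset.not_disjoint_iff.1 (Finset.mem_filter.1 hi).2
    exact ⟨x, hxe, hxP⟩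
  · rintro x - i ⟨-, hi⟩ j ⟨-, hj⟩
    by_contra hij
    exact Finset.disjoint_left.1 (hP i j hij) hi hj

/-- Deleting each member of a pairwise disjoint family in turn destroys a weighted family of sets
of size at most `d` at most `d` times in total. -/
theorem card_sub_mul_sum_le_sum_filter_disjoint {α κ ι : Type*} [DecidableEq α] [Fintype κ]
    (P : κ → Finset α) (hP : ∀ i j, i ≠ j → Disjoint (P i) (P j))
    (F : Finset ι) (g : ι → Finset α) (c : ι → ℝ) (hc : ∀ x ∈ F, 0 ≤ c x)
    (d : ℕ) (hg : ∀ x ∈ F, (g x).card ≤ d) :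
    ((Fintype.card κ : ℝ) - d) * ∑ x ∈ F, c x ≤
      ∑ i, ∑ x ∈ F.filter (fun x => Disjoint (g x) (P i)), c x := by
  simp_rw [Finset.sum_filter]
  rw [Finset.sum_comm, Finset.mul_sum]
  refine Finset.sum_le_sum fun x hx => ?_
  rw [← Finset.sum_filter, Finset.sum_const, nsmul_eq_mul]
  refine mul_le_mul_of_nonneg_right ?_ (hc x hx)
  have hle := (card_filter_not_disjoint_le P hP (g x)).trans (hg x hx)
  have hsum := Finset.card_filter_add_card_filter_not (s := (Finset.univ : Finset κ))
    (fun i => Disjoint (g x) (P i))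
  rw [Finset.card_univ] at hsum
  rw [sub_le_iff_le_add]
  exact_mod_cast (by omega : Fintype.card κ ≤
    (Finset.univ.filter (fun i => Disjoint (g x) (P i))).card + d)


/-- For graph valuations (all hyperedges of size 2) and any
partition `P 0, …, P k` of the goods `M`, some part `P i` can be discarded
while some allocation of the remaining goods `M \ P i` retains at least a
`(1 - 2/(k+1))` fraction of the welfare of a given allocation `A` of `M`. -/
theorem exists_part_removal_allocation_welfare
    {α : Type*} [DecidableEq α]
    (M : Finset α) (n : ℕ)
    (w : Fin n → α → ℝ) (E : Fin n → Finset (Finset α)) (we : Fin n → Finset α → ℝ)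
    (hw : ∀ ℓ j, 0 ≤ w ℓ j) (hwe : ∀ ℓ, ∀ e ∈ E ℓ, 0 ≤ we ℓ e)
    (hcard : ∀ ℓ, ∀ e ∈ E ℓ, e.card = 2)
    (val : Fin n → Finset α → ℝ)
    (hval : ∀ ℓ S, val ℓ S = ∑ j ∈ S, w ℓ j +
      ∑ e ∈ (E ℓ).filter (fun e => e ⊆ S), we ℓ e)
    (A : α → Fin n)
    (β : ℝ) (hβ : β = ∑ ℓ, val ℓ (M.filter (fun j => A j = ℓ)))
    (k : ℕ) (P : Fin (k + 1) → Finset α)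
    (hdisj : ∀ i j, i ≠ j → Disjoint (P i) (P j))
    (hcover : Finset.univ.biUnion P = M) :
    ∃ (i : Fin (k + 1)) (Ai : α → Fin n),
      ∑ ℓ, val ℓ ((M \ P i).filter (fun j => Ai j = ℓ)) ≥
        (1 - 2 / ((k : ℝ) + 1)) * β := by
  have key : ∀ ℓ S, ((k : ℝ) + 1 - 2) * val ℓ S ≤ ∑ i, val ℓ (S \ P i) := by
    intro ℓ S
    have goods := card_sub_mul_sum_le_sum_filter_disjoint P hdisj S (fun j => {j}) (w ℓ)
      (fun j _ => hw ℓ j) 2 (fun j _ => by simp)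
    have edges := card_sub_mul_sum_le_sum_filter_disjoint P hdisj
      ((E ℓ).filter (fun e => e ⊆ S)) id (we ℓ)
      (fun e he => hwe ℓ e (Finset.mem_filter.1 he).1) 2
      (fun e he => (hcard ℓ e (Finset.mem_filter.1 he).1).le)
    have hgoods : ∀ i, S.filter (fun j => Disjoint {j} (P i)) = S \ P i := by
      intro i
      ext j
      simp
    have hedges : ∀ i, ((E ℓ).filter (fun e => e ⊆ S)).filter (fun e => Disjoint (id e) (P i)) =
        (E ℓ).filter (fun e => e ⊆ S \ P i) := by
      intro i
      ext e
      simp [Finset.subset_sdiff, and_assoc]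
    simp only [hgoods, Fintype.card_fin] at goods
    simp only [hedges, Fintype.card_fin] at edges
    push_cast at goods edges
    simp only [hval, Finset.sum_add_distrib]
    linarith
  have total : ((k : ℝ) + 1 - 2) * β ≤
      ∑ i, ∑ ℓ, val ℓ ((M \ P i).filter (fun j => A j = ℓ)) := by
    rw [hβ, Finset.mul_sum, Finset.sum_comm]
    refine Finset.sum_le_sum fun ℓ _ => (key ℓ _).trans_eq (Finset.sum_congr rfl fun i _ => ?_)
    congr 1
    ext j
    simp only [Finset.mem_sdiff, Finset.mem_filter]
    tauto
  have hk : (0 : ℝ) < k + 1 := by positivity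
  have average : ∑ _i : Fin (k + 1), (1 - 2 / ((k : ℝ) + 1)) * β = ((k : ℝ) + 1 - 2) * β := by
    rw [Finset.sum_const, Finset.card_univ, Fintype.card_fin, nsmul_eq_mul]
    push_cast
    field_simp
  obtain ⟨i, -, hi⟩ := Finset.exists_le_of_sum_le Finset.univ_nonempty (average.trans_le total)
  exact ⟨i, A, hi⟩
end

section
/- Let r ≥ 1, let M be a finite set of goods, and let v_1, …, v_n be hypergraph-r valuations on M, where v_i has vertex weights w_{ij} ≥ 0 and hyperedge set E_i (every e ∈ E_i nonempty with |e| ≤ r) with weights w_{ie} ≥ 0. Suppose x_{ij} ≥ 0 (for players i and goods j) and z_{ie} ≥ 0 (for players i and e ∈ E_i) satisfy Σ_{i=1}^n x_{ij} = 1 for every good j, and z_{ie} ≤ x_{ij} for every player i, every e ∈ E_i, and every good j ∈ e. Then there exists a partition S_1, …, S_n of M such that Σ_{i=1}^n v_i(S_i) ≥ (1/r) · Σ_{i=1}^n ( Σ_{j∈M} w_{ij} x_{ij} + Σ_{e∈E_i} w_{ie} z_{ie} ). -/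
/-- The value of `S` under the hypergraph valuation with vertex weights `w`, hyperedges `E` and
hyperedge weights `u`. -/
def hypergraphValue {α : Type*} [DecidableEq α] (w : α → ℝ) (E : Finset (Finset α))
    (u : Finset α → ℝ) (S : Finset α) : ℝ :=
  ∑ j ∈ S, w j + ∑ e ∈ E with e ⊆ S, u e

/-- Layer-cake decomposition of a nonnegative function on a finite set `U` as a nonnegative
combination of indicators of nonempty subsets of `U`. -/
theorem exists_layer_decomposition {α : Type*} [DecidableEq α] (U : Finset α) (x : α → ℝ)
    (hx : ∀ j ∈ U, 0 ≤ x j) :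
    ∃ (k : ℕ) (c : Fin k → ℝ) (T : Fin k → Finset α),
      (∀ l, 0 ≤ c l) ∧ (∀ l, T l ⊆ U ∧ (T l).Nonempty) ∧
      (∀ j ∈ U, ∑ l, (if j ∈ T l then c l else 0) = x j) ∧
      (∀ e ⊆ U, e.Nonempty → ∀ t, (∀ j ∈ e, t ≤ x j) →
        t ≤ ∑ l, (if e ⊆ T l then c l else 0)) := by
  induction U using Finset.strongInduction generalizing x with
  | H U ih =>
    rcases U.eq_empty_or_nonempty with rfl | hU
    · refine ⟨0, Fin.elim0, Fin.elim0, fun l => l.elim0, fun l => l.elim0, by simp, ?_⟩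
      intro e he hne
      exact absurd (Finset.subset_empty.mp he) hne.ne_empty
    · obtain ⟨a, haU, ha⟩ := U.exists_min_image x hU
      obtain ⟨k, c, T, hc, hT, hsum, hle⟩ := ih (U.erase a) (Finset.erase_ssubset haU)
        (fun j => x j - x a) (fun j hj => sub_nonneg.mpr (ha j (Finset.mem_of_mem_erase hj)))
      have haT : ∀ l, a ∉ T l := fun l h => by simpa using (hT l).1 h
      refine ⟨k + 1, Fin.cons (x a) c, Fin.cons U T, ?_, ?_, ?_, ?_⟩
      · exact Fin.cases (by simpa using hx a haU) (by simpa using hc)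
      · refine Fin.cases (by simpa using hU) fun l => ?_
        simpa using ⟨(hT l).1.trans (Finset.erase_subset _ _), (hT l).2⟩
      · intro j hj
        rw [Fin.sum_univ_succ]
        simp only [Fin.cons_zero, Fin.cons_succ, hj, if_true]
        by_cases hja : j = a
        · subst hja
          simp [haT]
        · rw [hsum j (Finset.mem_erase.mpr ⟨hja, hj⟩)]
          ring
      · intro e he hne t ht
        rw [Fin.sum_univ_succ]
        simp only [Fin.cons_zero, Fin.cons_succ, he, if_true]
        by_cases hae : a ∈ e
        · have : 0 ≤ ∑ l, (if e ⊆ T l then c l else 0) :=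
            Finset.sum_nonneg fun l _ => by split_ifs <;> simp [hc]
          linarith [ht a hae]
        · have := hle e (Finset.subset_erase.mpr ⟨he, hae⟩) hne (t - x a)
            (fun j hj => by linarith [ht j hj])
          linarith

theorem hypergraphValue_eq_of_subset {α : Type*} [DecidableEq α] (w : α → ℝ)
    (E : Finset (Finset α)) (u : Finset α → ℝ) {S U : Finset α} (hSU : S ⊆ U) :
    hypergraphValue w E u S = ∑ j ∈ U, w j * (if j ∈ S then 1 else 0) +
      ∑ e ∈ E with e ⊆ U, u e * (if e ⊆ S then 1 else 0) := by
  unfold hypergraphValue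
  congr 1
  · simp only [mul_ite, mul_one, mul_zero, ← Finset.sum_filter]
    congr 1
    ext j
    simpa using @hSU j
  · simp only [mul_ite, mul_one, mul_zero, ← Finset.sum_filter, Finset.filter_filter]
    congr 1
    ext e
    simp only [Finset.mem_filter]
    exact ⟨fun h => ⟨h.1, h.2.trans hSU, h.2⟩, fun h => ⟨h.1, h.2.2⟩⟩

theorem sum_mul_sum_add_sum {ι α β : Type*} [Fintype ι] (c : ι → ℝ) (A : Finset α) (B : Finset β)
    (f : α → ℝ) (g : β → ℝ) (p : ι → α → ℝ) (q : ι → β → ℝ) :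
    ∑ l, c l * (∑ j ∈ A, f j * p l j + ∑ e ∈ B, g e * q l e) =
      ∑ j ∈ A, f j * ∑ l, c l * p l j + ∑ e ∈ B, g e * ∑ l, c l * q l e := by
  simp only [mul_add, Finset.mul_sum, Finset.sum_add_distrib]
  rw [Finset.sum_comm, Finset.sum_comm (t := B)]
  congr 1 <;> exact Finset.sum_congr rfl fun _ _ => Finset.sum_congr rfl fun _ _ => by ring

/-- A fractional assignment to one player is dominated by a layer decomposition of it. -/
theorem hypergraphValue_mul_le_sum {α ι : Type*} [DecidableEq α] [Fintype ι] (w : α → ℝ)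
    (E : Finset (Finset α)) (u : Finset α → ℝ) (x : α → ℝ) (z : Finset α → ℝ) (U : Finset α)
    (hu : ∀ e ∈ E, 0 ≤ u e) (c : ι → ℝ) (T : ι → Finset α) (hT : ∀ l, T l ⊆ U)
    (hx : ∀ j ∈ U, ∑ l, (if j ∈ T l then c l else 0) = x j)
    (hz : ∀ e ∈ E, e ⊆ U → z e ≤ ∑ l, (if e ⊆ T l then c l else 0)) :
    hypergraphValue (fun j => w j * x j) E (fun e => u e * z e) U ≤
      ∑ l, c l * hypergraphValue w E u (T l) := by
  simp_rw [fun l => hypergraphValue_eq_of_subset w E u (hT l)]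
  rw [sum_mul_sum_add_sum]
  simp only [mul_ite, mul_one, mul_zero]
  unfold hypergraphValue
  refine add_le_add (Finset.sum_le_sum fun j hj => by rw [hx j hj]) (Finset.sum_le_sum ?_)
  intro e he
  rw [Finset.mem_filter] at he
  exact mul_le_mul_of_nonneg_left (hz e he.1 he.2) (hu e he.1)

/-- If a weighted family of sets covers every good of `U` with total weight one, then deleting the
sets of the family from `U` costs in total at most `r` times the value of `U`. -/
theorem sum_mul_hypergraphValue_sub_sdiff_le {α ι : Type*} [DecidableEq α] [Fintype ι] {r : ℕ}
    (hr : 1 ≤ r) (w : α → ℝ) (E : Finset (Finset α)) (u : Finset α → ℝ) (U : Finset α)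
    (hw : ∀ j ∈ U, 0 ≤ w j) (hu : ∀ e ∈ E, 0 ≤ u e) (hE : ∀ e ∈ E, e.card ≤ r)
    (c : ι → ℝ) (hc : ∀ l, 0 ≤ c l) (T : ι → Finset α)
    (hcover : ∀ j ∈ U, ∑ l, (if j ∈ T l then c l else 0) = 1) :
    ∑ l, c l * (hypergraphValue w E u U - hypergraphValue w E u (U \ T l)) ≤
      r * hypergraphValue w E u U := by
  have hdiff : ∀ l, hypergraphValue w E u U - hypergraphValue w E u (U \ T l) =
      ∑ j ∈ U, w j * (if j ∈ T l then 1 else 0) +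
        ∑ e ∈ E with e ⊆ U, u e * (if Disjoint e (T l) then 0 else 1) := by
    intro l
    rw [hypergraphValue_eq_of_subset w E u (Finset.sdiff_subset (s := U) (t := T l)),
      hypergraphValue, add_sub_add_comm, ← Finset.sum_sub_distrib, ← Finset.sum_sub_distrib]
    congr 1
    · refine Finset.sum_congr rfl fun j hj => ?_
      by_cases h : j ∈ T l <;> simp [hj, h]
    · refine Finset.sum_congr rfl fun e he => ?_
      have he' := (Finset.mem_filter.mp he).2
      by_cases h : Disjoint e (T l) <;> simp [Finset.subset_sdiff, he', h]
  simp_rw [hdiff]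
  rw [sum_mul_sum_add_sum, hypergraphValue, mul_add, Finset.mul_sum, Finset.mul_sum]
  have hr' : (1 : ℝ) ≤ r := by exact_mod_cast hr
  refine add_le_add (Finset.sum_le_sum fun j hj => ?_) (Finset.sum_le_sum fun e he => ?_)
  · simp only [mul_ite, mul_one, mul_zero]
    rw [hcover j hj]
    nlinarith [hw j hj]
  · obtain ⟨heE, heU⟩ := Finset.mem_filter.mp he
    rw [mul_comm (r : ℝ)]
    refine mul_le_mul_of_nonneg_left ?_ (hu e heE)
    calc ∑ l, c l * (if Disjoint e (T l) then (0 : ℝ) else 1)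
        ≤ ∑ l, ∑ j ∈ e, (if j ∈ T l then c l else 0) := by
          refine Finset.sum_le_sum fun l _ => ?_
          have hnn : ∀ j ∈ e, 0 ≤ (if j ∈ T l then c l else 0) :=
            fun j _ => by split_ifs <;> simp [hc]
          split_ifs with h
          · simpa using Finset.sum_nonneg hnn
          · obtain ⟨j, hje, hjT⟩ := Finset.not_disjoint_iff.mp h
            simpa [hjT] using Finset.single_le_sum hnn hje
      _ = ∑ j ∈ e, (1 : ℝ) := by
          rw [Finset.sum_comm]
          exact Finset.sum_congr rfl fun j hj => hcover j (heU hj)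
      _ ≤ r := by simpa using hE e heE

theorem hypergraphValue_add_le_union {α : Type*} [DecidableEq α] (w : α → ℝ)
    (E : Finset (Finset α)) (u : Finset α → ℝ) (hu : ∀ e ∈ E, 0 ≤ u e)
    (hE : ∀ e ∈ E, e.Nonempty) {S T : Finset α} (hST : Disjoint S T) :
    hypergraphValue w E u S + hypergraphValue w E u T ≤ hypergraphValue w E u (S ∪ T) := by
  unfold hypergraphValue
  have hdisj : Disjoint ({e ∈ E | e ⊆ S}) ({e ∈ E | e ⊆ T}) := by
    refine Finset.disjoint_left.mpr fun e h₁ h₂ => ?_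
    rw [Finset.mem_filter] at h₁ h₂
    exact (hE e h₁.1).ne_empty
      (Finset.subset_empty.mp (hST.le_bot.trans' (Finset.subset_inter h₁.2 h₂.2)))
  have hsub : ({e ∈ E | e ⊆ S}) ∪ ({e ∈ E | e ⊆ T}) ⊆ ({e ∈ E | e ⊆ S ∪ T}) := by
    intro e he
    simp only [Finset.mem_union, Finset.mem_filter] at he ⊢
    rcases he with h | h
    · exact ⟨h.1, h.2.trans Finset.subset_union_left⟩
    · exact ⟨h.1, h.2.trans Finset.subset_union_right⟩
  have hle := Finset.sum_le_sum_of_subset_of_nonneg (f := u) hsub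
    (fun e he _ => hu e (Finset.mem_filter.mp he).1)
  rw [Finset.sum_union hdisj] at hle
  rw [Finset.sum_union hST]
  linarith

/-- One rounding step: some nonempty bundle `T` can be given to some player `i` so that `r` times
its value pays for the decrease of the LP objective. -/
theorem exists_bundle_value_ge_loss {α : Type*} [DecidableEq α] {n r : ℕ} (hr : 1 ≤ r)
    (U : Finset α) (hU : U.Nonempty)
    (w : Fin n → α → ℝ) (E : Fin n → Finset (Finset α)) (u : Fin n → Finset α → ℝ)
    (hw : ∀ i j, 0 ≤ w i j) (hu : ∀ i, ∀ e ∈ E i, 0 ≤ u i e)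
    (hE : ∀ i, ∀ e ∈ E i, e.Nonempty ∧ e.card ≤ r)
    (x : Fin n → α → ℝ) (z : Fin n → Finset α → ℝ)
    (hx : ∀ i j, 0 ≤ x i j) (hz : ∀ i e, 0 ≤ z i e)
    (hsum : ∀ j ∈ U, ∑ i, x i j = 1)
    (hzx : ∀ i, ∀ e ∈ E i, ∀ j ∈ e, z i e ≤ x i j) :
    ∃ i, ∃ T ⊆ U, T.Nonempty ∧
      ∑ i', (hypergraphValue (fun j => w i' j * x i' j) (E i') (fun e => u i' e * z i' e) U -
        hypergraphValue (fun j => w i' j * x i' j) (E i') (fun e => u i' e * z i' e) (U \ T)) ≤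
      r * hypergraphValue (w i) (E i) (u i) T := by
  choose k c T hc hT hcx hcz using fun i => exists_layer_decomposition U (x i) fun j _ => hx i j
  set L : Fin n → Finset α → ℝ := fun i =>
    hypergraphValue (fun j => w i j * x i j) (E i) (fun e => u i e * z i e) with hL
  have hcover : ∀ j ∈ U, ∑ p : Σ i, Fin (k i),
      (if j ∈ T p.1 p.2 then c p.1 p.2 else 0) = 1 := by
    intro j hj
    rw [Fintype.sum_sigma, ← hsum j hj]
    exact Finset.sum_congr rfl fun i _ => hcx i j hj
  have hgain : ∑ i, L i U ≤ ∑ p : Σ i, Fin (k i),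
      c p.1 p.2 * hypergraphValue (w p.1) (E p.1) (u p.1) (T p.1 p.2) := by
    rw [Fintype.sum_sigma]
    exact Finset.sum_le_sum fun i _ => hypergraphValue_mul_le_sum _ _ _ _ _ _ (hu i) _ _
      (fun l => (hT i l).1) (hcx i) fun e he heU => hcz i e heU (hE i e he).1 _ (hzx i e he)
  have hloss : ∑ p : Σ i, Fin (k i), c p.1 p.2 * ∑ i', (L i' U - L i' (U \ T p.1 p.2)) ≤
      r * ∑ i, L i U := by
    simp_rw [Finset.mul_sum]
    rw [Finset.sum_comm]
    exact Finset.sum_le_sum fun i' _ => sum_mul_hypergraphValue_sub_sdiff_le hr _ _ _ _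
      (fun j _ => mul_nonneg (hw i' j) (hx i' j))
      (fun e he => mul_nonneg (hu i' e he) (hz i' e)) (fun e he => (hE i' e he).2)
      (fun p : Σ i, Fin (k i) => c p.1 p.2) (fun p => hc p.1 p.2) (fun p => T p.1 p.2) hcover
  by_contra! hcon
  obtain ⟨a, ha⟩ := hU
  have hpos : ∃ p : Σ i, Fin (k i), 0 < c p.1 p.2 := by
    by_contra! h
    have : ∑ p : Σ i, Fin (k i), (if a ∈ T p.1 p.2 then c p.1 p.2 else 0) ≤ 0 :=
      Finset.sum_nonpos fun p _ => by split_ifs <;> simp [h]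
    linarith [hcover a ha]
  obtain ⟨q, hq⟩ := hpos
  have hlt : ∑ p : Σ i, Fin (k i),
        c p.1 p.2 * (r * hypergraphValue (w p.1) (E p.1) (u p.1) (T p.1 p.2)) <
      ∑ p : Σ i, Fin (k i), c p.1 p.2 * ∑ i', (L i' U - L i' (U \ T p.1 p.2)) := by
    have hstep := fun p : Σ i, Fin (k i) =>
      hcon p.1 (T p.1 p.2) (hT p.1 p.2).1 (hT p.1 p.2).2
    exact Finset.sum_lt_sum
      (fun p _ => mul_le_mul_of_nonneg_left (hstep p).le (hc p.1 p.2))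
      ⟨q, Finset.mem_univ q, mul_lt_mul_of_pos_left (hstep q) hq⟩
  have hr0 : (0 : ℝ) ≤ r := Nat.cast_nonneg r
  have := mul_le_mul_of_nonneg_left hgain hr0
  rw [Finset.mul_sum (s := Finset.univ (α := Σ i, Fin (k i)))] at this
  simp_rw [mul_left_comm (r : ℝ)] at this
  linarith

/-- Iterating the rounding step allocates any set `U` of goods. -/
theorem exists_partition_LP_le_mul_welfare {α : Type*} [DecidableEq α] {n r : ℕ} (hr : 1 ≤ r)
    (U : Finset α)
    (w : Fin n → α → ℝ) (E : Fin n → Finset (Finset α)) (u : Fin n → Finset α → ℝ)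
    (hw : ∀ i j, 0 ≤ w i j) (hu : ∀ i, ∀ e ∈ E i, 0 ≤ u i e)
    (hE : ∀ i, ∀ e ∈ E i, e.Nonempty ∧ e.card ≤ r)
    (x : Fin n → α → ℝ) (z : Fin n → Finset α → ℝ)
    (hx : ∀ i j, 0 ≤ x i j) (hz : ∀ i e, 0 ≤ z i e)
    (hsum : ∀ j ∈ U, ∑ i, x i j = 1)
    (hzx : ∀ i, ∀ e ∈ E i, ∀ j ∈ e, z i e ≤ x i j) :
    ∃ S : Fin n → Finset α,
      (∀ i i', i ≠ i' → Disjoint (S i) (S i')) ∧ Finset.univ.biUnion S = U ∧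
      ∑ i, hypergraphValue (fun j => w i j * x i j) (E i) (fun e => u i e * z i e) U ≤
        r * ∑ i, hypergraphValue (w i) (E i) (u i) (S i) := by
  induction U using Finset.strongInduction with
  | H U ih =>
    rcases U.eq_empty_or_nonempty with rfl | hU
    · refine ⟨fun _ => ∅, by simp, by ext; simp, ?_⟩
      have hzero : ∀ i (f : α → ℝ) (g : Finset α → ℝ), hypergraphValue f (E i) g ∅ = 0 := by
        intro i f g
        have : {e ∈ E i | e ⊆ ∅} = ∅ := Finset.filter_eq_empty_iff.mpr fun e he h =>
          (hE i e he).1.ne_empty (Finset.subset_empty.mp h)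
        rw [hypergraphValue, this, Finset.sum_empty, Finset.sum_empty, add_zero]
      simp [hzero]
    · obtain ⟨i₀, T, hTU, hTne, hT⟩ :=
        exists_bundle_value_ge_loss hr U hU w E u hw hu hE x z hx hz hsum hzx
      obtain ⟨S, hdisj, hunion, hS⟩ := ih (U \ T) (Finset.sdiff_ssubset hTU hTne)
        (fun j hj => hsum j (Finset.mem_sdiff.mp hj).1)
      have hST : ∀ i, Disjoint (S i) T := fun i =>
        Finset.disjoint_of_subset_left
          (hunion ▸ Finset.subset_biUnion_of_mem S (Finset.mem_univ i)) Finset.sdiff_disjoint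
      refine ⟨fun i => if i = i₀ then S i ∪ T else S i, ?_, ?_, ?_⟩
      · intro i i' hne
        dsimp only
        split_ifs with h h'
        · exact absurd (h.trans h'.symm) hne
        · exact Finset.disjoint_union_left.mpr ⟨hdisj i i' hne, (hST i').symm⟩
        · exact Finset.disjoint_union_right.mpr ⟨hdisj i i' hne, hST i⟩
        · exact hdisj i i' hne
      · have : Finset.univ.biUnion (fun i => if i = i₀ then S i ∪ T else S i) =
            Finset.univ.biUnion S ∪ T := by
          ext j
          simp only [Finset.mem_biUnion, Finset.mem_univ, true_and, Finset.mem_union]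
          constructor
          · rintro ⟨i, hi⟩
            split_ifs at hi
            · exact (Finset.mem_union.mp hi).imp_left fun h => ⟨i, h⟩
            · exact Or.inl ⟨i, hi⟩
          · rintro (⟨i, hi⟩ | hj)
            · refine ⟨i, ?_⟩
              split_ifs
              · exact Finset.mem_union_left _ hi
              · exact hi
            · exact ⟨i₀, by simp [hj]⟩
        rw [this, hunion, Finset.sdiff_union_of_subset hTU]
      · have hstep : ∑ i, (hypergraphValue (w i) (E i) (u i) (S i) +
              if i = i₀ then hypergraphValue (w i) (E i) (u i) T else 0) ≤
            ∑ i, hypergraphValue (w i) (E i) (u i) (if i = i₀ then S i ∪ T else S i) := by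
          refine Finset.sum_le_sum fun i _ => ?_
          split_ifs
          · exact hypergraphValue_add_le_union _ _ _ (hu i) (fun e he => (hE i e he).1) (hST i)
          · simp
        rw [Finset.sum_add_distrib, Finset.sum_ite_eq' Finset.univ i₀
          (fun i => hypergraphValue (w i) (E i) (u i) T), if_pos (Finset.mem_univ i₀)] at hstep
        rw [Finset.sum_sub_distrib] at hT
        have := mul_le_mul_of_nonneg_left hstep (Nat.cast_nonneg r : (0 : ℝ) ≤ r)
        rw [mul_add] at this
        linarith

/-- Rounding guarantee for the LP relaxation with hypergraph-r
valuations: every feasible fractional solution `(x, z)` admits a partition of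
the goods whose welfare is at least `1/r` times the LP objective value. -/
theorem exists_partition_welfare_ge_LP_div_r
    {α : Type*} [DecidableEq α]
    (M : Finset α) (n r : ℕ) (hr : 1 ≤ r)
    (w : Fin n → α → ℝ) (E : Fin n → Finset (Finset α)) (we : Fin n → Finset α → ℝ)
    (hw : ∀ i j, 0 ≤ w i j) (hwe : ∀ i, ∀ e ∈ E i, 0 ≤ we i e)
    (hE : ∀ i, ∀ e ∈ E i, e.Nonempty ∧ e.card ≤ r ∧ e ⊆ M)
    (val : Fin n → Finset α → ℝ)
    (hval : ∀ i S, val i S = ∑ j ∈ S, w i j +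
      ∑ e ∈ (E i).filter (fun e => e ⊆ S), we i e)
    (x : Fin n → α → ℝ) (z : Fin n → Finset α → ℝ)
    (hxnn : ∀ i j, 0 ≤ x i j) (hznn : ∀ i e, 0 ≤ z i e)
    (hsum : ∀ j ∈ M, ∑ i, x i j = 1)
    (hzx : ∀ i, ∀ e ∈ E i, ∀ j ∈ e, z i e ≤ x i j) :
    ∃ S : Fin n → Finset α,
      (∀ i i', i ≠ i' → Disjoint (S i) (S i')) ∧
      Finset.univ.biUnion S = M ∧
      ∑ i, val i (S i) ≥
        (1 / (r : ℝ)) *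
          ∑ i, (∑ j ∈ M, w i j * x i j + ∑ e ∈ E i, we i e * z i e) := by
  obtain ⟨S, hdisj, hunion, hS⟩ := exists_partition_LP_le_mul_welfare hr M w E we hw hwe
    (fun i e he => ⟨(hE i e he).1, (hE i e he).2.1⟩) x z hxnn hznn hsum hzx
  refine ⟨S, hdisj, hunion, ?_⟩
  have hr0 : (0 : ℝ) < r := by exact_mod_cast hr
  have hLP : ∀ i, hypergraphValue (fun j => w i j * x i j) (E i) (fun e => we i e * z i e) M =
      ∑ j ∈ M, w i j * x i j + ∑ e ∈ E i, we i e * z i e := fun i => by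
    rw [hypergraphValue, Finset.filter_true_of_mem fun e he => (hE i e he).2.2]
  simp_rw [hLP] at hS
  simp_rw [hval]
  rw [ge_iff_le, one_div, inv_mul_le_iff₀ hr0]
  exact hS
end

section
/- Let r ≥ 1 and B ≥ 1, let M be a finite set of goods, let v_1, …, v_n be hypergraph-r valuations on M with nonnegative weights, and let v'_1, …, v'_n be the corresponding proxy valuations. Then for every partition S_1, …, S_n of M there exists a feasible solution y of the B-duplicate configuration LP — i.e., y_{i,S} ≥ 0 for all players i and nonempty bundles S ⊆ M, with Σ_{S ≠ ∅} y_{i,S} ≤ 1 for every player i and Σ_{i=1}^n Σ_{S : j∈S} y_{i,S} ≤ B for every good j — whose objective value Σ_{i,S≠∅} v'_i(S) · y_{i,S} is at least (Σ_{i=1}^n v_i(S_i)) / B^r. Consequently, the optimum of the configuration LP with proxy valuations is at least the optimal welfare divided by B^r. -/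
/-- Each edge of size at most `r` loses at most a factor `B ^ r` in the proxy valuation. -/
theorem hypergraph_valuation_div_pow_le_proxy {α : Type*}
    {r : ℕ} (hr : 1 ≤ r) {B : ℝ} (hB : 1 ≤ B) (w : α → ℝ) (we : Finset α → ℝ)
    (S : Finset α) (F : Finset (Finset α)) (hw : ∀ j, 0 ≤ w j)
    (hwe : ∀ e ∈ F, 0 ≤ we e) (hF : ∀ e ∈ F, e.card ≤ r) :
    (∑ j ∈ S, w j + ∑ e ∈ F, we e) / B ^ r ≤
      ∑ j ∈ S, w j / B + ∑ e ∈ F, we e / B ^ e.card := by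
  have hB0 : 0 < B := by linarith
  rw [add_div, Finset.sum_div, Finset.sum_div]
  refine add_le_add (Finset.sum_le_sum fun j _ => ?_) (Finset.sum_le_sum fun e he => ?_)
  · exact div_le_div_of_nonneg_left (hw j) hB0 (le_self_pow₀ hB (by omega))
  · exact div_le_div_of_nonneg_left (hwe e he) (pow_pos hB0 _) (pow_le_pow_right₀ hB (hF e he))

/-- every partition of the goods induces a feasible solution of
the `B`-duplicate configuration LP with proxy valuations whose objective value
is at least the welfare of the partition divided by `B ^ r`. -/
theorem configuration_LP_opt_ge_welfare_div_B_pow_r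
    {α : Type*} [DecidableEq α]
    (M : Finset α) (n r : ℕ) (hr : 1 ≤ r) (B : ℝ) (hB : 1 ≤ B)
    (w : Fin n → α → ℝ) (E : Fin n → Finset (Finset α)) (we : Fin n → Finset α → ℝ)
    (hw : ∀ i j, 0 ≤ w i j) (hwe : ∀ i, ∀ e ∈ E i, 0 ≤ we i e)
    (hE : ∀ i, ∀ e ∈ E i, e.Nonempty ∧ e.card ≤ r ∧ e ⊆ M)
    (v v' : Fin n → Finset α → ℝ)
    (hv : ∀ i S, v i S = ∑ j ∈ S, w i j +
      ∑ e ∈ (E i).filter (fun e => e ⊆ S), we i e)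
    (hv' : ∀ i S, v' i S = ∑ j ∈ S, w i j / B +
      ∑ e ∈ (E i).filter (fun e => e ⊆ S), we i e / B ^ e.card)
    (part : Fin n → Finset α)
    (hdisj : ∀ i i', i ≠ i' → Disjoint (part i) (part i'))
    (hcover : Finset.univ.biUnion part = M) :
    ∃ y : Fin n → Finset α → ℝ,
      (∀ i S, 0 ≤ y i S) ∧
      (∀ i, ∑ S ∈ M.powerset.filter Finset.Nonempty, y i S ≤ 1) ∧
      (∀ j ∈ M, ∑ i, ∑ S ∈ (M.powerset.filter Finset.Nonempty).filter
        (fun S => j ∈ S), y i S ≤ B) ∧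
      ∑ i, ∑ S ∈ M.powerset.filter Finset.Nonempty, v' i S * y i S ≥
        (∑ i, v i (part i)) / B ^ r := by
  have hsub : ∀ i, part i ⊆ M := fun i =>
    hcover ▸ Finset.subset_biUnion_of_mem part (Finset.mem_univ i)
  refine ⟨fun i S => if S = part i then 1 else 0, fun i S => by positivity, fun i => ?_,
    fun j _ => ?_, ?_⟩
  · rw [Finset.sum_ite_eq']
    split_ifs <;> norm_num
  · refine le_trans ?_ hB
    simp only [Finset.sum_ite_eq', Finset.sum_boole]
    rw [Nat.cast_le_one, Finset.card_le_one]
    intro a ha b hb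
    by_contra hab
    simp only [Finset.mem_filter] at ha hb
    exact Finset.disjoint_left.mp (hdisj a b hab) ha.2.2 hb.2.2
  · rw [ge_iff_le, Finset.sum_div]
    refine Finset.sum_le_sum fun i _ => ?_
    simp only [mul_ite, mul_one, mul_zero, Finset.sum_ite_eq', Finset.mem_filter,
      Finset.mem_powerset, hsub i, true_and]
    split_ifs with hne
    · rw [hv, hv']
      exact hypergraph_valuation_div_pow_le_proxy hr hB (w i) (we i) (part i) _ (hw i)
        (fun e he => hwe i e (Finset.mem_filter.mp he).1)
        (fun e he => (hE i e (Finset.mem_filter.mp he).1).2.1)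
    · rw [Finset.not_nonempty_iff_eq_empty] at hne
      have hfilter : (E i).filter (fun e => e ⊆ part i) = ∅ :=
        Finset.filter_eq_empty_iff.mpr fun e he hsubset =>
          (hE i e he).1.ne_empty (Finset.subset_empty.mp (hne ▸ hsubset))
      rw [hv, hfilter, hne]
      simp
end

section
/- Let M be a finite set of goods partitioned into three pairwise disjoint sets M₁, X, M₂ (with M₁ ∪ X ∪ M₂ = M), and let v_1, …, v_n be hypergraph valuations on M with nonnegative weights w_{ℓj} (goods j) and hyperedge sets E_ℓ with nonnegative weights w_{ℓe}, such that no hyperedge e ∈ E_ℓ (for any player ℓ) intersects both M₁ and M₂. For an assignment A : Y → {1, …, n} of a subset Y ⊆ M, define the welfare W_Y(A) = Σ_{ℓ=1}^n ( Σ_{j∈Y : A(j)=ℓ} w_{ℓj} + Σ_{e∈E_ℓ : e⊆Y and A(j)=ℓ for all j∈e} w_{ℓe} ). Then for every partial assignment A' : X → {1, …, n}: max over assignments A : M → {1,…,n} with A restricted to X equal to A' of W_M(A) equals [max over assignments A₁ : M₁ ∪ X → {1,…,n} agreeing with A' on X of W_{M₁∪X}(A₁)] + [max over assignments A₂ : M₂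 ∪ X → {1,…,n} agreeing with A' on X of W_{M₂∪X}(A₂)] − W_X(A'). -/
open Finset in
/-- Bundle values over the assignment `A` satisfy a modular identity across a separator `X`
that no hyperedge crosses. -/
theorem bundle_value_add_eq_of_separator {α ι : Type*} [DecidableEq α] [DecidableEq ι]
    {M₁ X M₂ : Finset α}
    (hd₁X : Disjoint M₁ X) (hd₁₂ : Disjoint M₁ M₂) (hdX₂ : Disjoint X M₂)
    (w : α → ℝ) (E : Finset (Finset α)) (we : Finset α → ℝ)
    (hE : ∀ e ∈ E, e ⊆ M₁ ∪ X ∪ M₂)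
    (hsep : ∀ e ∈ E, ¬((e ∩ M₁).Nonempty ∧ (e ∩ M₂).Nonempty))
    (A : α → ι) (ℓ : ι) :
    (∑ j ∈ (M₁ ∪ X ∪ M₂).filter (fun j => A j = ℓ), w j +
        ∑ e ∈ E.filter (fun e => e ⊆ M₁ ∪ X ∪ M₂ ∧ ∀ j ∈ e, A j = ℓ), we e) +
      (∑ j ∈ X.filter (fun j => A j = ℓ), w j +
        ∑ e ∈ E.filter (fun e => e ⊆ X ∧ ∀ j ∈ e, A j = ℓ), we e) =
    (∑ j ∈ (M₁ ∪ X).filter (fun j => A j = ℓ), w j +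
        ∑ e ∈ E.filter (fun e => e ⊆ M₁ ∪ X ∧ ∀ j ∈ e, A j = ℓ), we e) +
      (∑ j ∈ (M₂ ∪ X).filter (fun j => A j = ℓ), w j +
        ∑ e ∈ E.filter (fun e => e ⊆ M₂ ∪ X ∧ ∀ j ∈ e, A j = ℓ), we e) := by
  have goods : ∑ j ∈ (M₁ ∪ X ∪ M₂).filter (fun j => A j = ℓ), w j +
      ∑ j ∈ X.filter (fun j => A j = ℓ), w j =
      ∑ j ∈ (M₁ ∪ X).filter (fun j => A j = ℓ), w j +
      ∑ j ∈ (M₂ ∪ X).filter (fun j => A j = ℓ), w j := by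
    simp only [sum_filter]
    rw [sum_union (disjoint_union_left.2 ⟨hd₁₂, hdX₂⟩), sum_union hd₁X, sum_union hdX₂.symm]
    ring
  have edges : ∑ e ∈ E.filter (fun e => e ⊆ M₁ ∪ X ∪ M₂ ∧ ∀ j ∈ e, A j = ℓ), we e +
      ∑ e ∈ E.filter (fun e => e ⊆ X ∧ ∀ j ∈ e, A j = ℓ), we e =
      ∑ e ∈ E.filter (fun e => e ⊆ M₁ ∪ X ∧ ∀ j ∈ e, A j = ℓ), we e +
      ∑ e ∈ E.filter (fun e => e ⊆ M₂ ∪ X ∧ ∀ j ∈ e, A j = ℓ), we e := by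
    simp only [sum_filter, ← sum_add_distrib]
    refine sum_congr rfl fun e he => ?_
    have hM := hE e he
    have hX : e ⊆ X ↔ e ⊆ M₁ ∪ X ∧ e ⊆ M₂ ∪ X := by
      refine ⟨fun h => ⟨h.trans subset_union_right, h.trans subset_union_right⟩,
        fun ⟨h₁, h₂⟩ j hj => ?_⟩
      rcases mem_union.1 (h₁ hj) with h | h
      · exact (mem_union.1 (h₂ hj)).resolve_left (disjoint_left.1 hd₁₂ h)
      · exact h
    have hor : e ⊆ M₁ ∪ X ∨ e ⊆ M₂ ∪ X := by
      by_contra! h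
      obtain ⟨⟨a, ha, ha'⟩, b, hb, hb'⟩ := And.imp not_subset.1 not_subset.1 h
      have hMa := hM ha
      have hMb := hM hb
      simp only [mem_union] at ha' hb' hMa hMb
      exact hsep e he ⟨⟨b, mem_inter.2 ⟨hb, by tauto⟩⟩, ⟨a, mem_inter.2 ⟨ha, by tauto⟩⟩⟩
    by_cases h₁ : e ⊆ M₁ ∪ X <;> by_cases h₂ : e ⊆ M₂ ∪ X
    · simp [-union_assoc, hX, h₁, h₂, hM]
    · simp [-union_assoc, hX, h₁, h₂, hM]
    · simp [-union_assoc, hX, h₁, h₂, hM]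
    · tauto
  linarith

/-- Over finitely many assignments, if `F + c = G + H` on the assignments extending `A'` on `X`,
where `G` and `H` only depend on the values on `M₁ ∪ X` and `M₂ ∪ X`, then the maxima satisfy
the same relation. -/
theorem sSup_extensions_eq_add_sub {α ι : Type*} [DecidableEq α] [Finite α] [Finite ι]
    {M₁ X M₂ : Finset α} (hd₁₂ : Disjoint M₁ M₂)
    (A' : α → ι) (F G H : (α → ι) → ℝ) (c : ℝ)
    (hF : ∀ A, (∀ j ∈ X, A j = A' j) → F A + c = G A + H A)
    (hG : ∀ A B, (∀ j ∈ M₁ ∪ X, A j = B j) → G A = G B)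
    (hH : ∀ A B, (∀ j ∈ M₂ ∪ X, A j = B j) → H A = H B) :
    sSup {x : ℝ | ∃ A : α → ι, (∀ j ∈ X, A j = A' j) ∧ x = F A} =
      sSup {x : ℝ | ∃ A : α → ι, (∀ j ∈ X, A j = A' j) ∧ x = G A} +
      sSup {x : ℝ | ∃ A : α → ι, (∀ j ∈ X, A j = A' j) ∧ x = H A} - c := by
  have fin (K : (α → ι) → ℝ) :
      {x : ℝ | ∃ A : α → ι, (∀ j ∈ X, A j = A' j) ∧ x = K A}.Finite :=
    (Set.finite_range K).subset fun x ⟨A, _, hx⟩ => ⟨A, hx.symm⟩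
  have le (K : (α → ι) → ℝ) (A : α → ι) (hA : ∀ j ∈ X, A j = A' j) :
      K A ≤ sSup {x : ℝ | ∃ A : α → ι, (∀ j ∈ X, A j = A' j) ∧ x = K A} :=
    le_csSup (fin K).bddAbove ⟨A, hA, rfl⟩
  have attained (K : (α → ι) → ℝ) :
      ∃ A : α → ι, (∀ j ∈ X, A j = A' j) ∧
        sSup {x : ℝ | ∃ A : α → ι, (∀ j ∈ X, A j = A' j) ∧ x = K A} = K A :=
    Set.Nonempty.csSup_mem (s := {x : ℝ | ∃ A : α → ι, (∀ j ∈ X, A j = A' j) ∧ x = K A})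
      ⟨K A', A', fun _ _ => rfl, rfl⟩ (fin K)
  obtain ⟨A, hA, hFA⟩ := attained F
  obtain ⟨A₁, hA₁, hGA₁⟩ := attained G
  obtain ⟨A₂, hA₂, hHA₂⟩ := attained H
  apply le_antisymm
  · linarith [hF A hA, le G A hA, le H A hA]
  · let B : α → ι := fun j => if j ∈ M₂ then A₂ j else A₁ j
    have hB : ∀ j ∈ X, B j = A' j := fun j hj => by
      by_cases h : j ∈ M₂ <;> simp [B, h, hA₁ j hj, hA₂ j hj]
    have hB₁ : G B = G A₁ := hG _ _ fun j hj => by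
      rcases Finset.mem_union.1 hj with h | h
      · simp [B, Finset.disjoint_left.1 hd₁₂ h]
      · rw [hB j h, hA₁ j h]
    have hB₂ : H B = H A₂ := hH _ _ fun j hj => by
      rcases Finset.mem_union.1 hj with h | h
      · simp [B, h]
      · rw [hB j h, hA₂ j h]
    linarith [hF B hB, le F B hB]

/-- optimal-substructure identity for welfare maximization with
hypergraph valuations across a separator `X`: when no hyperedge meets both
`M₁` and `M₂`, the best welfare on `M = M₁ ∪ X ∪ M₂` consistent with the
partial assignment `A'` on `X` splits as the sum of the best welfares on
`M₁ ∪ X` and on `M₂ ∪ X`, minus the doubly-counted welfare of `X`. -/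
theorem welfare_dynamic_programming_identity
    {α : Type*} [DecidableEq α] [Fintype α]
    (M M₁ X M₂ : Finset α)
    (hd₁X : Disjoint M₁ X) (hd₁₂ : Disjoint M₁ M₂) (hdX₂ : Disjoint X M₂)
    (hcover : M₁ ∪ X ∪ M₂ = M)
    (n : ℕ)
    (w : Fin n → α → ℝ) (E : Fin n → Finset (Finset α)) (we : Fin n → Finset α → ℝ)
    (hw : ∀ ℓ j, 0 ≤ w ℓ j) (hwe : ∀ ℓ, ∀ e ∈ E ℓ, 0 ≤ we ℓ e)
    (hEne : ∀ ℓ, ∀ e ∈ E ℓ, e.Nonempty ∧ e ⊆ M)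
    (hsep : ∀ ℓ, ∀ e ∈ E ℓ, ¬((e ∩ M₁).Nonempty ∧ (e ∩ M₂).Nonempty))
    (W : Finset α → (α → Fin n) → ℝ)
    (hW : ∀ Y A, W Y A = ∑ ℓ, (∑ j ∈ Y.filter (fun j => A j = ℓ), w ℓ j +
      ∑ e ∈ (E ℓ).filter (fun e => e ⊆ Y ∧ ∀ j ∈ e, A j = ℓ), we ℓ e))
    (A' : α → Fin n) :
    sSup {x : ℝ | ∃ A : α → Fin n, (∀ j ∈ X, A j = A' j) ∧ x = W M A} =
      sSup {x : ℝ | ∃ A : α → Fin n, (∀ j ∈ X, A j = A' j) ∧ x = W (M₁ ∪ X) A} +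
      sSup {x : ℝ | ∃ A : α → Fin n, (∀ j ∈ X, A j = A' j) ∧ x = W (M₂ ∪ X) A} -
      W X A' := by
  have local_W : ∀ Y A B, (∀ j ∈ Y, A j = B j) → W Y A = W Y B := by
    intro Y A B hAB
    rw [hW, hW]
    refine Finset.sum_congr rfl fun ℓ _ => ?_
    congr 1
    · exact Finset.sum_congr (Finset.filter_congr fun j hj => by rw [hAB j hj]) fun _ _ => rfl
    · refine Finset.sum_congr (Finset.filter_congr fun e _ => and_congr_right fun he => ?_)
        fun _ _ => rfl
      exact forall₂_congr fun j hj => by rw [hAB j (he hj)]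
  subst hcover
  refine sSup_extensions_eq_add_sub hd₁₂ A' (W (M₁ ∪ X ∪ M₂)) (W (M₁ ∪ X)) (W (M₂ ∪ X)) (W X A')
    (fun A hA => ?_) (local_W _) (local_W _)
  rw [← local_W X A A' hA]
  rw [hW, hW, hW, hW, ← Finset.sum_add_distrib, ← Finset.sum_add_distrib]
  refine Finset.sum_congr rfl fun ℓ _ => ?_
  convert bundle_value_add_eq_of_separator hd₁X hd₁₂ hdX₂ (w ℓ) (E ℓ) (we ℓ)
    (fun e he => (hEne ℓ e he).2) (hsep ℓ) A ℓ
end
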